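/- Let f be a minmax monotone cost function on a finite tree T_in, let 𝒯 ≥ 0, and let T = (V,E) be a working subtree with sink set S ⊆ V. If no ordered pair (u,v) ∈ V × V satisfies the peaking criterion and S = ∅, then for every vertex s ∈ V one has f(V, s) ≤ 𝒯. -/

import Mathlib

open SimpleGraph Set
open scoped ENNReal

variable {V : Type*}

/-- The vertex set of the connected component of the subgraph of `G` induced on `A`
containing the vertex `u` (empty if `u ∉ A`). -/
def reachSet (G : SimpleGraph V) (A : Set V) (u : V) : Set V :=
  {y | ∃ (hu : u ∈ A) (hy : y ∈ A), (G.induce A).Reachable ⟨u, hu⟩ ⟨y, hy⟩}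

/-- `U` is a subtree: the induced subgraph on `U` is connected. -/
def IsSubtree (G : SimpleGraph V) (U : Set V) : Prop :=
  (G.induce U).Connected

/-- A minmax monotone cost function on the tree `G`:
`f {s} s = 0`; `f U s = ∞` if `U` is not a subtree or `s ∉ U`; set monotonicity;
path monotonicity; and max tree composition (the slices of `U` defined by `s` being the
connected components of `U \ {s}`). -/
structure IsMinmaxMonotone (G : SimpleGraph V) (f : Set V → V → ℝ≥0∞) : Prop where
  singleton_eq_zero : ∀ s : V, f {s} s = 0
  eq_top_of_not_subtree : ∀ (U : Set V) (s : V), ¬ IsSubtree G U → f U s = ⊤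
  eq_top_of_not_mem : ∀ (U : Set V) (s : V), s ∉ U → f U s = ⊤
  set_mono : ∀ (U₁ U₂ : Set V) (s : V), IsSubtree G U₁ → IsSubtree G U₂ →
    s ∈ U₁ → U₁ ⊆ U₂ → f U₁ s ≤ f U₂ s
  path_mono : ∀ (U : Set V) (s u : V), IsSubtree G U → s ∉ U → u ∈ U → G.Adj s u →
    f U u ≤ f (U ∪ {s}) s
  max_comp : ∀ (U : Set V) (s : V), IsSubtree G U → s ∈ U →
    f U s = ⨆ x ∈ U \ {s}, f (reachSet G (U \ {s}) x ∪ {s}) s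

/-- `s` is a leaf of the (working) tree induced on `W`. -/
def IsLeafOf (G : SimpleGraph V) (W : Set V) (s : V) : Prop :=
  s ∈ W ∧ ∃! u, u ∈ W ∧ G.Adj s u

/-- The ordered pair `(u,v)` satisfies the peaking criterion in the working tree on `W`
with sink set `S` and threshold `𝒯`. -/
def PeakingPair (G : SimpleGraph V) (f : Set V → V → ℝ≥0∞) (𝒯 : ℝ≥0∞)
    (W S : Set V) (u v : V) : Prop :=
  u ∈ W ∧ v ∈ W ∧ G.Adj u v ∧ S ∩ reachSet G (W \ {v}) u = ∅ ∧
    f (reachSet G (W \ {v}) u) u ≤ 𝒯 ∧ 𝒯 < f (reachSet G (W \ {v}) u ∪ {v}) v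

/-- `w` lies on the unique path from `a` to `b` in the tree induced on `W`. -/
def OnPath (G : SimpleGraph V) (W : Set V) (a b w : V) : Prop :=
  a ∈ W ∧ b ∈ W ∧ w ∈ W ∧ b ∉ reachSet G (W \ {w}) a

/-- Vertices of the hub tree: union of the paths from the sinks to the root `r`. -/
def hubVerts (G : SimpleGraph V) (W S : Set V) (r : V) : Set V :=
  {w | ∃ s ∈ S, OnPath G W s r w}

/-- `r` is a valid root: a non-sink vertex of the working tree such that at least two of
the subtrees hanging off it contain sinks. -/
def GoodRoot (G : SimpleGraph V) (W S : Set V) (r : V) : Prop :=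
  r ∈ W ∧ r ∉ S ∧
    ∃ η₁ η₂ : V, η₁ ≠ η₂ ∧ η₁ ∈ W ∧ η₂ ∈ W ∧ G.Adj r η₁ ∧ G.Adj r η₂ ∧
      (S ∩ reachSet G (W \ {r}) η₁).Nonempty ∧ (S ∩ reachSet G (W \ {r}) η₂).Nonempty

/-- The working tree on `W` is RC-viable w.r.t. sinks `S` and root `r`: every outstanding
branch, together with the hub-tree node it is attached to, has cost at most `𝒯`. -/
def RCViable (G : SimpleGraph V) (f : Set V → V → ℝ≥0∞) (𝒯 : ℝ≥0∞)
    (W S : Set V) (r : V) : Prop :=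
  ∀ w ∈ hubVerts G W S r, ∀ η ∈ W, G.Adj w η → η ∉ hubVerts G W S r →
    f (reachSet G (W \ {w}) η ∪ {w}) w ≤ 𝒯

/-- The set `A` is self-sufficient: it can be partitioned into subtree blocks, one for
each sink in `S ∩ A`, each block containing its sink and having cost at most `𝒯`. -/
def SelfSufficient (G : SimpleGraph V) (f : Set V → V → ℝ≥0∞) (𝒯 : ℝ≥0∞)
    (S A : Set V) : Prop :=
  ∃ P : V → Set V,
    (⋃ s ∈ S ∩ A, P s) = A ∧
    (∀ s ∈ S ∩ A, IsSubtree G (P s) ∧ s ∈ P s ∧ f (P s) s ≤ 𝒯) ∧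
    (S ∩ A).Pairwise fun s t => Disjoint (P s) (P t)

/-- The vertices of the path `Π(a,b)` in the tree induced on `W`. -/
def pathSet (G : SimpleGraph V) (W : Set V) (a b : V) : Set V :=
  {w | OnPath G W a b w}

/-- All vertices of outstanding branches attached to `w` (given hub-tree vertices `Hub`). -/
def branchesAt (G : SimpleGraph V) (W Hub : Set V) (w : V) : Set V :=
  ⋃ η ∈ {η : V | η ∈ W ∧ G.Adj w η ∧ η ∉ Hub}, reachSet G (W \ {w}) η

/-- The bulk path `BP(a,b)`: the path `Π(a,b)` together with all outstanding branches
attached to its vertices. -/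
def bulkPath (G : SimpleGraph V) (W S : Set V) (r a b : V) : Set V :=
  pathSet G W a b ∪ ⋃ w ∈ pathSet G W a b, branchesAt G W (hubVerts G W S r) w

/-- `v` is the parent of `u` in the hub tree rooted at `r`. -/
def HubParent (G : SimpleGraph V) (W S : Set V) (r u v : V) : Prop :=
  u ∈ hubVerts G W S r ∧ v ∈ hubVerts G W S r ∧ G.Adj u v ∧ OnPath G W u r v

/-- The ordered pair `(u,v)` satisfies the reaching criterion: `v` is the hub-tree parent
of `u`, `T₋ᵥ(u)` is self-sufficient, and `BP(v,v) ∪ V₋ᵥ(u)` is not self-sufficient. -/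
def ReachingPair (G : SimpleGraph V) (f : Set V → V → ℝ≥0∞) (𝒯 : ℝ≥0∞)
    (W S : Set V) (r u v : V) : Prop :=
  HubParent G W S r u v ∧
  SelfSufficient G f 𝒯 S (reachSet G (W \ {v}) u) ∧
  ¬ SelfSufficient G f 𝒯 S (bulkPath G W S r v v ∪ reachSet G (W \ {v}) u)

/-- The vertex set `V(v)` of the subtree of the working tree (rooted at `r`) rooted at `v`:
all vertices whose path to the root passes through `v`. -/
def rootedBelow (G : SimpleGraph V) (W : Set V) (r v : V) : Set V :=
  {x | OnPath G W x r v}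

/-- The rooted subtree `T(v)` is RC-viable: every outstanding branch attached to a
hub-tree node lying in `T(v)` has, together with its attachment node, cost at most `𝒯`. -/
def RCViableBelow (G : SimpleGraph V) (f : Set V → V → ℝ≥0∞) (𝒯 : ℝ≥0∞)
    (W S : Set V) (r v : V) : Prop :=
  ∀ w ∈ hubVerts G W S r ∩ rootedBelow G W r v, ∀ η ∈ W, G.Adj w η →
    η ∉ hubVerts G W S r → f (reachSet G (W \ {w}) η ∪ {w}) w ≤ 𝒯

/-- The subtree with vertex set `A` (of the working tree rooted at `r`) is recursively
self-sufficient: for every hub-tree node `w` in `A`, the part of `A` lying below `w`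
is self-sufficient. -/
def RecursivelySelfSufficientOn (G : SimpleGraph V) (f : Set V → V → ℝ≥0∞) (𝒯 : ℝ≥0∞)
    (W S : Set V) (r : V) (A : Set V) : Prop :=
  ∀ w ∈ hubVerts G W S r ∩ A, SelfSufficient G f 𝒯 S (rootedBelow G W r w ∩ A)

/-- A feasible sink configuration: a partition of all of `V_in` into subtree blocks,
one per sink, each block containing exactly its own sink and having cost at most `𝒯`. -/
def IsFeasibleConfig (G : SimpleGraph V) (f : Set V → V → ℝ≥0∞) (𝒯 : ℝ≥0∞)
    (St : Set V) (P : V → Set V) : Prop :=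
  (⋃ s ∈ St, P s) = Set.univ ∧
  St.Pairwise (fun s t => Disjoint (P s) (P t)) ∧
  ∀ s ∈ St, IsSubtree G (P s) ∧ St ∩ P s = {s} ∧ f (P s) s ≤ 𝒯

/-- An optimal feasible sink configuration: one with the minimum number of sinks. -/
def IsOptimalConfig (G : SimpleGraph V) (f : Set V → V → ℝ≥0∞) (𝒯 : ℝ≥0∞)
    (St : Set V) (P : V → Set V) : Prop :=
  IsFeasibleConfig G f 𝒯 St P ∧
  ∀ (St' : Set V) (P' : V → Set V), IsFeasibleConfig G f 𝒯 St' P' → St.ncard ≤ St'.ncard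

/-- A partial sink configuration relative to the working tree on `W`: pairwise disjoint
subtree blocks of cost at most `𝒯`, one per sink of `Sout`, covering `V_in \ (W \ Sout)`. -/
def IsPartialConfig (G : SimpleGraph V) (f : Set V → V → ℝ≥0∞) (𝒯 : ℝ≥0∞)
    (W : Set V) (Sout : Set V) (P : V → Set V) : Prop :=
  Sout.Pairwise (fun s t => Disjoint (P s) (P t)) ∧
  (∀ s ∈ Sout, IsSubtree G (P s) ∧ s ∈ P s ∧ f (P s) s ≤ 𝒯) ∧
  (⋃ s ∈ Sout, P s) = Set.univ \ (W \ Sout)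

/-- `(St, Pt)` is an optimal feasible sink configuration witnessing the optimality of the
partial configuration `(Sout, P)` relative to the working tree on `W` (conditions (C1)-(C3)). -/
def WitnessesOptimality (G : SimpleGraph V) (f : Set V → V → ℝ≥0∞) (𝒯 : ℝ≥0∞)
    (W : Set V) (Sout : Set V) (P : V → Set V) (St : Set V) (Pt : V → Set V) : Prop :=
  IsOptimalConfig G f 𝒯 St Pt ∧
  Sout ⊆ St ∧
  St \ W = Sout \ W ∧
  (∀ s ∈ Sout ∩ W, IsLeafOf G W s) ∧
  (∀ s ∈ St, s ∉ W → Pt s = P s ∧ Pt s ∩ W = ∅) ∧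
  (∀ s ∈ Sout ∩ W, P s ⊆ Pt s ∧ Pt s \ P s ⊆ W) ∧
  (∀ s ∈ St, s ∉ Sout → Pt s ⊆ W)

/-- The partial sink configuration `(Sout, P)` is optimal relative to the working tree on `W`. -/
def OptimalRelative (G : SimpleGraph V) (f : Set V → V → ℝ≥0∞) (𝒯 : ℝ≥0∞)
    (W : Set V) (Sout : Set V) (P : V → Set V) : Prop :=
  ∃ (St : Set V) (Pt : V → Set V), WitnessesOptimality G f 𝒯 W Sout P St Pt

theorem reachSet_subset (G : SimpleGraph V) (A : Set V) (u : V) : reachSet G A u ⊆ A :=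
  fun _ ⟨_, hy, _⟩ => hy

theorem self_mem_reachSet {G : SimpleGraph V} {A : Set V} {u : V} (hu : u ∈ A) :
    u ∈ reachSet G A u :=
  ⟨hu, hu, Reachable.refl _⟩

theorem mem_reachSet_of_adj {G : SimpleGraph V} {A : Set V} {u y z : V}
    (hy : y ∈ reachSet G A u) (hz : z ∈ A) (h : G.Adj y z) : z ∈ reachSet G A u := by
  obtain ⟨hu, hyA, hr⟩ := hy
  have hadj : (G.induce A).Adj ⟨y, hyA⟩ ⟨z, hz⟩ := h
  exact ⟨hu, hz, hr.trans hadj.reachable⟩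

theorem reachSet_eq_of_mem {G : SimpleGraph V} {A : Set V} {u x : V}
    (hx : x ∈ reachSet G A u) : reachSet G A x = reachSet G A u := by
  obtain ⟨hu, hxA, hr⟩ := hx
  ext y
  exact ⟨fun ⟨_, hy, h⟩ => ⟨hu, hy, hr.trans h⟩, fun ⟨_, hy, h⟩ => ⟨hxA, hy, hr.symm.trans h⟩⟩

/-- Induction along walks inside `A` starting at `u`. -/
theorem reachSet_induction {G : SimpleGraph V} {A : Set V} {u : V} {P : V → Prop}
    (base : P u)
    (step : ∀ y z, y ∈ reachSet G A u → P y → z ∈ A → G.Adj y z → P z)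
    {y : V} (hy : y ∈ reachSet G A u) : P y := by
  obtain ⟨hu, hyA, hr⟩ := hy
  rw [reachable_iff_reflTransGen] at hr
  suffices h : ∀ b : A, Relation.ReflTransGen (G.induce A).Adj ⟨u, hu⟩ b → P b from h _ hr
  intro b hb
  induction hb with
  | refl => exact base
  | @tail b c hb hbc ih =>
    exact step b c ⟨hu, b.2, (reachable_iff_reflTransGen _ _).2 hb⟩ ih c.2 hbc

theorem reachSet_mono {G : SimpleGraph V} {A B : Set V} (h : A ⊆ B) (u : V) :
    reachSet G A u ⊆ reachSet G B u := fun _ hy =>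
  reachSet_induction (self_mem_reachSet (h hy.1))
    (fun _ _ _ ih hz hadj => mem_reachSet_of_adj ih (h hz) hadj) hy

theorem IsSubtree.mem_reachSet {G : SimpleGraph V} {A : Set V} (hA : IsSubtree G A) {u y : V}
    (hu : u ∈ A) (hy : y ∈ A) : y ∈ reachSet G A u :=
  ⟨hu, hy, hA.preconnected _ _⟩

theorem isSubtree_of_subset_reachSet {G : SimpleGraph V} {A : Set V} {u : V} (hu : u ∈ A)
    (h : A ⊆ reachSet G A u) : IsSubtree G A := by
  refine (connected_iff_exists_forall_reachable _).2 ⟨⟨u, hu⟩, fun y => ?_⟩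
  obtain ⟨_, _, hr⟩ := h y.2
  exact hr

theorem isSubtree_reachSet {G : SimpleGraph V} {A : Set V} {u : V} (hu : u ∈ A) :
    IsSubtree G (reachSet G A u) :=
  isSubtree_of_subset_reachSet (self_mem_reachSet hu) fun _ hy =>
    reachSet_induction (P := fun y => y ∈ reachSet G (reachSet G A u) u)
      (self_mem_reachSet (self_mem_reachSet hu))
      (fun _ _ hy ih hz hadj => mem_reachSet_of_adj ih (mem_reachSet_of_adj hy hz hadj) hadj) hy

theorem IsSubtree.union_singleton {G : SimpleGraph V} {A : Set V} (hA : IsSubtree G A)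
    {u s : V} (hu : u ∈ A) (h : G.Adj s u) : IsSubtree G (A ∪ {s}) := by
  refine isSubtree_of_subset_reachSet (Or.inl hu) ?_
  rintro y (hy | rfl)
  · exact reachSet_mono subset_union_left u (hA.mem_reachSet hu hy)
  · exact mem_reachSet_of_adj (self_mem_reachSet (Or.inl hu)) (Or.inr rfl) h.symm

/-- Every vertex of a subtree other than `s` lies in a slice containing a neighbour of `s`. -/
theorem IsSubtree.exists_adj_mem_reachSet {G : SimpleGraph V} {A : Set V} (hA : IsSubtree G A)
    {s x : V} (hs : s ∈ A) (hx : x ∈ A) (hxs : x ≠ s) :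
    ∃ w ∈ A, G.Adj s w ∧ x ∈ reachSet G (A \ {s}) w := by
  refine (reachSet_induction
    (P := fun y => y = s ∨ ∃ w ∈ A, G.Adj s w ∧ y ∈ reachSet G (A \ {s}) w)
    (Or.inl rfl) ?_ (hA.mem_reachSet hs hx)).resolve_left hxs
  intro y z _ ih hz hadj
  by_cases hzs : z = s
  · exact Or.inl hzs
  right
  rcases ih with rfl | ⟨w, hw, hsw, hy⟩
  · exact ⟨z, hz, hadj, self_mem_reachSet ⟨hz, hzs⟩⟩
  · exact ⟨w, hw, hsw, mem_reachSet_of_adj hy ⟨hz, hzs⟩ hadj⟩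

theorem IsMinmaxMonotone.le_of_forall_adj {G : SimpleGraph V} {f : Set V → V → ℝ≥0∞}
    (hf : IsMinmaxMonotone G f) {𝒯 : ℝ≥0∞} {A W : Set V} (hA : IsSubtree G A) (hAW : A ⊆ W)
    {s : V} (hs : s ∈ A)
    (h : ∀ w ∈ A, G.Adj s w → f (reachSet G (W \ {s}) w ∪ {s}) s ≤ 𝒯) : f A s ≤ 𝒯 := by
  rw [hf.max_comp A s hA hs]
  refine iSup₂_le fun x hx => ?_
  obtain ⟨w, hw, hsw, hxw⟩ := hA.exists_adj_mem_reachSet hs hx.1 hx.2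
  have hwA : w ∈ A \ {s} := ⟨hw, hsw.ne'⟩
  have hwW : w ∈ W \ {s} := ⟨hAW hw, hsw.ne'⟩
  rw [reachSet_eq_of_mem hxw]
  exact (hf.set_mono _ _ s
    ((isSubtree_reachSet hwA).union_singleton (self_mem_reachSet hwA) hsw)
    ((isSubtree_reachSet hwW).union_singleton (self_mem_reachSet hwW) hsw)
    (Or.inr rfl)
    (union_subset_union_left _ (reachSet_mono (sdiff_subset_sdiff_left hAW) w))).trans (h w hw hsw)

/-- In an acyclic graph, removing `u` separates its distinct neighbours `v` and `w`. -/
theorem SimpleGraph.IsAcyclic.notMem_reachSet {G : SimpleGraph V} (hG : G.IsAcyclic)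
    {W : Set V} {u v w : V} (huv : G.Adj u v) (huw : G.Adj u w) (hwv : w ≠ v) :
    v ∉ reachSet G (W \ {u}) w := by
  intro hv
  have hb := isBridge_iff.1 (isAcyclic_iff_forall_adj_isBridge.1 hG huv)
  refine hb (reachSet_induction
    (P := fun y => (G.deleteEdges {s(u, v)}).Reachable u y) ?_ ?_ hv)
  · refine Adj.reachable ?_
    simp [huw, hwv, huv.ne]
  · intro y z hy ih hz hadj
    refine ih.trans (Adj.reachable ?_)
    have hyu : y ≠ u := (reachSet_subset _ _ _ hy).2
    have hzu : z ≠ u := hz.2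
    simp [hadj, hyu, hzu]

theorem SimpleGraph.IsAcyclic.reachSet_ssubset {G : SimpleGraph V} (hG : G.IsAcyclic)
    {W : Set V} {u v w : V} (huv : G.Adj u v) (huw : G.Adj u w) (hwv : w ≠ v)
    (hu : u ∈ W) (hw : w ∈ W) :
    reachSet G (W \ {u}) w ⊂ reachSet G (W \ {v}) u := by
  have huR : u ∈ reachSet G (W \ {v}) u := self_mem_reachSet ⟨hu, huv.ne⟩
  refine ssubset_of_subset_of_ssubset (fun y hy => ?_) (sdiff_singleton_ssubset.2 huR)
  refine ⟨reachSet_induction (P := fun y => y ∈ reachSet G (W \ {v}) u)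
    (mem_reachSet_of_adj huR ⟨hw, hwv⟩ huw) ?_ hy, (reachSet_subset _ _ _ hy).2⟩
  intro y z hy ih hz hadj
  refine mem_reachSet_of_adj ih ⟨hz.1, ?_⟩ hadj
  rintro rfl
  exact hG.notMem_reachSet huv huw hwv (mem_reachSet_of_adj hy hz hadj)

/-- Without sinks and peaking pairs, every slice has cost at most `𝒯` at its attachment
vertex. -/
theorem IsMinmaxMonotone.slice_le_of_forall_not_peakingPair [Finite V] {G : SimpleGraph V}
    (hG : G.IsAcyclic) {f : Set V → V → ℝ≥0∞} (hf : IsMinmaxMonotone G f) {𝒯 : ℝ≥0∞} {W : Set V}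
    (hnopeak : ∀ u v : V, ¬ PeakingPair G f 𝒯 W ∅ u v) {u v : V} (hu : u ∈ W) (hv : v ∈ W)
    (huv : G.Adj u v) : f (reachSet G (W \ {v}) u ∪ {v}) v ≤ 𝒯 := by
  induction hn : (reachSet G (W \ {v}) u).ncard using Nat.strong_induction_on
    generalizing u v with
  | _ n ih =>
  subst hn
  have huR : u ∈ W \ {v} := ⟨hu, huv.ne⟩
  have hsub : reachSet G (W \ {v}) u ⊆ W := (reachSet_subset _ _ _).trans sdiff_subset
  by_contra hlt
  refine hnopeak u v ⟨hu, hv, huv, empty_inter _, ?_, not_le.1 hlt⟩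
  refine hf.le_of_forall_adj (isSubtree_reachSet huR) hsub (self_mem_reachSet huR) ?_
  intro w hw huw
  have hwv : w ≠ v := (reachSet_subset _ _ _ hw).2
  exact ih _ (ncard_lt_ncard (hG.reachSet_ssubset huv huw hwv hu (hsub hw)) (toFinite _))
    (hsub hw) hu huw.symm rfl

/-- if no ordered pair satisfies the peaking criterion and `S = ∅`, then
every vertex `s` of the working tree satisfies `f(V, s) ≤ 𝒯`. -/
theorem statement_1 [Fintype V] (G : SimpleGraph V) (hG : G.IsTree)
    (f : Set V → V → ℝ≥0∞) (hf : IsMinmaxMonotone G f) (𝒯 : ℝ≥0∞)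
    (W S : Set V) (hW : IsSubtree G W) (hSW : S ⊆ W)
    (hSleaf : ∀ s ∈ S, IsLeafOf G W s)
    (hnopeak : ∀ u v : V, ¬ PeakingPair G f 𝒯 W S u v)
    (hSempty : S = ∅) :
    ∀ s ∈ W, f W s ≤ 𝒯 := by
  subst hSempty
  exact fun s hs => hf.le_of_forall_adj hW subset_rfl hs fun w hw hsw =>
    hf.slice_le_of_forall_not_peakingPair hG.isAcyclic hnopeak hw hs hsw.symm
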